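/- Let κ ∈ ℝ with κ ≠ 0, let d ≥ 1, and let x ∈ ℝ^d. Suppose ψ : ℝ^d → ℂ is differentiable on a neighborhood of x with derivative differentiable at x, A : ℝ^d → ℝ^d is differentiable at x, and χ : ℝ^d → ℝ is differentiable on a neighborhood of x with derivative differentiable at x. Define ζ = ψ·exp(iκχ), Q = A + ∇χ, F = (1/κ)∇ψ − iψA, and F′ = (1/κ)∇ζ − iζQ (vector fields with values in ℂ^d). Then the second-order covariant operator transforms covariantly at x: (1/κ)·div F′(x) − i·⟨Q(x), F′(x)⟩ = exp(iκχ(x)) · ((1/κ)·div F(x) − i·⟨A(x), F(x)⟩), where div G = Σⱼ ∂ⱼGⱼ and ⟨v, w⟩ = Σⱼ vⱼwⱼ. Equivalently, ((1/κ)∇ − iQ)²ζ = exp(iκχ)·((1/κ)∇ − iA)²ψ at x. -/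

import Mathlib

/-- The covariant gradient `F = (1/κ)∇ψ − iψA`, component `j`, at `y`. -/
noncomputable def covGrad (d : ℕ) (κ : ℝ) (ψ : (Fin d → ℝ) → ℂ)
    (A : (Fin d → ℝ) → (Fin d → ℝ)) (y : Fin d → ℝ) (j : Fin d) : ℂ :=
  (1 / (κ : ℂ)) * fderiv ℝ ψ y (Pi.single j 1)
    - Complex.I * ψ y * ((A y j : ℝ) : ℂ)

/-- The second-order covariant operator `((1/κ)∇ − iA)²ψ = (1/κ)div F − i⟨A, F⟩`
applied to the covariant gradient `F = (1/κ)∇ψ − iψA`, at `x`. -/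
noncomputable def covLap (d : ℕ) (κ : ℝ) (ψ : (Fin d → ℝ) → ℂ)
    (A : (Fin d → ℝ) → (Fin d → ℝ)) (x : Fin d → ℝ) : ℂ :=
  (1 / (κ : ℂ)) *
      (∑ j : Fin d, fderiv ℝ (fun y => covGrad d κ ψ A y j) x (Pi.single j 1))
    - Complex.I * ∑ j : Fin d, ((A x j : ℝ) : ℂ) * covGrad d κ ψ A x j

theorem fderiv_exp_phase_mul_apply {E : Type*} [NormedAddCommGroup E] [NormedSpace ℝ E]
    {κ : ℝ} {χ : E → ℝ} {f : E → ℂ} {y : E}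
    (hχ : DifferentiableAt ℝ χ y) (hf : DifferentiableAt ℝ f y) (v : E) :
    fderiv ℝ (fun z => Complex.exp (Complex.I * κ * χ z) * f z) y v
      = Complex.exp (Complex.I * κ * χ y)
          * (fderiv ℝ f y v + Complex.I * κ * (fderiv ℝ χ y v : ℝ) * f y) := by
  have hc : HasFDerivAt (fun z => (χ z : ℂ)) (Complex.ofRealCLM.comp (fderiv ℝ χ y)) y :=
    Complex.ofRealCLM.hasFDerivAt.comp y hχ.hasFDerivAt
  have h := (hc.const_mul (Complex.I * κ)).cexp.fun_mul hf.hasFDerivAt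
  rw [h.fderiv]
  simp
  ring

theorem covGrad_gauge_transform {d : ℕ} {κ : ℝ} (hκ : κ ≠ 0) {ψ : (Fin d → ℝ) → ℂ}
    (A : (Fin d → ℝ) → (Fin d → ℝ)) {χ : (Fin d → ℝ) → ℝ} {y : Fin d → ℝ}
    (hψ : DifferentiableAt ℝ ψ y) (hχ : DifferentiableAt ℝ χ y) (j : Fin d) :
    covGrad d κ (fun y => Complex.exp (Complex.I * κ * χ y) * ψ y)
        (fun y => A y + (fun j => fderiv ℝ χ y (Pi.single j 1))) y j
      = Complex.exp (Complex.I * κ * χ y) * covGrad d κ ψ A y j := by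
  have hκ' : (κ : ℂ) ≠ 0 := Complex.ofReal_ne_zero.mpr hκ
  simp only [covGrad, fderiv_exp_phase_mul_apply hχ hψ, Pi.add_apply, Complex.ofReal_add]
  field_simp
  ring

theorem differentiableAt_covGrad {d : ℕ} {κ : ℝ} {ψ : (Fin d → ℝ) → ℂ}
    {A : (Fin d → ℝ) → (Fin d → ℝ)} {x : Fin d → ℝ} (hψ : DifferentiableAt ℝ ψ x)
    (hψ' : DifferentiableAt ℝ (fderiv ℝ ψ) x) (hA : DifferentiableAt ℝ A x) (j : Fin d) :
    DifferentiableAt ℝ (fun y => covGrad d κ ψ A y j) x := by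
  have hAj : DifferentiableAt ℝ (fun y => ((A y j : ℝ) : ℂ)) x :=
    Complex.ofRealCLM.differentiableAt.comp x (differentiableAt_pi.mp hA j)
  exact ((hψ'.clm_apply (differentiableAt_const _)).const_mul _).sub
    ((hψ.const_mul _).mul hAj)

/-- the second-order covariant operator transforms covariantly
under the gauge transformation `ζ = exp(iκχ)ψ`, `Q = A + ∇χ`:
`((1/κ)∇ − iQ)²ζ = exp(iκχ)·((1/κ)∇ − iA)²ψ` at `x`. -/
theorem covariant_laplacian_gauge_transform
    (d : ℕ) (hd : 1 ≤ d) (κ : ℝ) (hκ : κ ≠ 0) (x : Fin d → ℝ)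
    (ψ : (Fin d → ℝ) → ℂ) (A : (Fin d → ℝ) → (Fin d → ℝ)) (χ : (Fin d → ℝ) → ℝ)
    (hψ : ∀ᶠ y in nhds x, DifferentiableAt ℝ ψ y)
    (hψ' : DifferentiableAt ℝ (fderiv ℝ ψ) x)
    (hA : DifferentiableAt ℝ A x)
    (hχ : ∀ᶠ y in nhds x, DifferentiableAt ℝ χ y)
    (hχ' : DifferentiableAt ℝ (fderiv ℝ χ) x) :
    covLap d κ (fun y => Complex.exp (Complex.I * κ * χ y) * ψ y)
        (fun y => A y + (fun j => fderiv ℝ χ y (Pi.single j 1))) x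
      = Complex.exp (Complex.I * κ * χ x) * covLap d κ ψ A x := by
  have hκ' : (κ : ℂ) ≠ 0 := Complex.ofReal_ne_zero.mpr hκ
  have hdiv (j : Fin d) := Filter.EventuallyEq.fderiv_eq (𝕜 := ℝ) ((hψ.and hχ).mono fun y hy =>
    covGrad_gauge_transform hκ A hy.1 hy.2 j)
  simp only [covLap, hdiv, covGrad_gauge_transform hκ A hψ.self_of_nhds hχ.self_of_nhds,
    fderiv_exp_phase_mul_apply hχ.self_of_nhds
      (differentiableAt_covGrad hψ.self_of_nhds hψ' hA _),
    Pi.add_apply, Complex.ofReal_add, Finset.mul_sum, ← Finset.sum_sub_distrib]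
  refine Finset.sum_congr rfl fun j _ => ?_
  field_simp
  ring
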